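/- arXiv:2410.15070 — 3 statements merged into one kernel-verified Lean document; each statement's English description precedes it below -/
import Mathlib

section
/- Let q = 3^s with s > 1 an integer, let 0 < i < s with gcd(i, s) = 1, and let h = (q − 3^i)/2 or h = (3^i − 1)/2. Then the codewords of Hamming weight 5 in the BCH code C_h support a 3-(q+1, 5, (q−3)(q−7)/2) design: for every 3-element subset T of {0, 1, …, q}, the number of 5-element subsets S of {0, 1, …, q} with T ⊆ S such that S is the support of some codeword of C_h equals (q − 3)(q − 7)/2. -/
open Finset in
lemma two_mul_card_blockFree {J : Type*} [Fintype J] [DecidableEq J] (B : Finset J → Prop)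
    [DecidablePred B]
    (hB : ∀ T : Finset J, T.card = 3 → ∃! x, x ∉ T ∧ B (insert x T))
    (T : Finset J) (hT : T.card = 3) :
    2 * (univ.filter fun S : Finset J =>
      S.card = 5 ∧ T ⊆ S ∧ ∀ x ∈ S, ¬ B (S.erase x)).card =
      (Fintype.card J - 4) * (Fintype.card J - 8) := by
  set G := univ.filter fun S : Finset J =>
      S.card = 5 ∧ T ⊆ S ∧ ∀ x ∈ S, ¬ B (S.erase x) with hG
  have huniq : ∀ R : Finset J, R.card = 3 → ∀ x y, x ∉ R → y ∉ R → B (insert x R) →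
      B (insert y R) → x = y := fun R hR x y hx hy bx bY =>
    (hB R hR).unique ⟨hx, bx⟩ ⟨hy, bY⟩
  obtain ⟨d, ⟨hdT, hd⟩, -⟩ := hB T hT
  have key := sum_card_bipartiteAbove_eq_sum_card_bipartiteBelow (s := G)
    (t := (insert d T)ᶜ) (fun S a => a ∈ S)
  have h1 : ∀ S ∈ G, (bipartiteAbove (fun S a => a ∈ S) (insert d T)ᶜ S).card = 2 := by
    intro S hS
    simp only [hG, mem_filter, mem_univ, true_and] at hS
    obtain ⟨h5, hTS, hfree⟩ := hS
    have hdS : d ∉ S := by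
      intro hdS
      have hsub : insert d T ⊆ S := insert_subset hdS hTS
      have hc : (S \ insert d T).card = 1 := by
        rw [card_sdiff_of_subset hsub, card_insert_of_notMem hdT]; omega
      obtain ⟨x, hx⟩ := card_eq_one.mp hc
      have hxS : x ∈ S \ insert d T := by rw [hx]; simp
      refine hfree x (mem_sdiff.mp hxS).1 ?_
      convert hd
      rw [erase_eq, ← hx, Finset.sdiff_sdiff_eq_self hsub]
    have : bipartiteAbove (fun S a => a ∈ S) (insert d T)ᶜ S = S \ T := by
      ext x
      simp only [bipartiteAbove, mem_filter, mem_compl, mem_insert, mem_sdiff]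
      grind
    rw [this, card_sdiff_of_subset hTS]; omega
  have h2 : ∀ a ∈ (insert d T)ᶜ,
      (bipartiteBelow (fun S a => a ∈ S) G a).card = Fintype.card J - 8 := by
    intro a ha
    simp only [mem_compl, mem_insert, not_or] at ha
    obtain ⟨had, haT⟩ := ha
    have hNa : ¬ B (insert a T) := fun h => had (huniq T hT a d haT hdT h hd)
    have hR : ∀ p ∈ T, (insert a (T.erase p)).card = 3 := fun p hp => by
      rw [card_insert_of_notMem (by simp [haT]), card_erase_of_mem hp]; omega
    have hex : ∀ p, ∃ x, p ∈ T →
        x ∉ insert a (T.erase p) ∧ B (insert x (insert a (T.erase p))) := fun p => by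
      by_cases hp : p ∈ T
      · obtain ⟨x, hx, -⟩ := hB _ (hR p hp)
        exact ⟨x, fun _ => hx⟩
      · exact ⟨p, fun h => absurd h hp⟩
    choose g hg using hex
    have hgp : ∀ p ∈ T, g p ≠ p := fun p hp h => by
      have := (hg p hp).2
      rw [h, Finset.insert_comm, insert_erase hp] at this
      exact hNa this
    have hgT : ∀ p ∈ T, g p ∉ T := fun p hp h => by
      have := (hg p hp).1
      simp only [mem_insert, mem_erase, not_or, not_and] at this
      exact this.2 (hgp p hp) h
    have hga : ∀ p ∈ T, g p ≠ a := fun p hp h => (hg p hp).1 (by simp [h])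
    have hgd : ∀ p ∈ T, g p ≠ d := fun p hp h => by
      have hb := (hg p hp).2
      rw [h, Finset.insert_comm] at hb
      have hc : (insert d (T.erase p)).card = 3 := by
        rw [card_insert_of_notMem (by simp [hdT]), card_erase_of_mem hp]; omega
      have := huniq _ hc a p (by simp [had, haT])
        (by simp only [mem_insert, mem_erase]; grind) hb
        (by rw [Finset.insert_comm, insert_erase hp]; exact hd)
      exact haT (this ▸ hp)
    have hginj : Set.InjOn g T := by
      intro p hp p' hp' h
      by_contra hne
      have hb := (hg p hp).2
      have hb' := (hg p' hp').2
      rw [← h] at hb'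
      have e : insert (g p) (insert a (T.erase p)) =
          insert p' (insert (g p) (insert a ((T.erase p).erase p'))) := by
        ext x; simp only [mem_insert, mem_erase]; grind
      have e' : insert (g p) (insert a (T.erase p')) =
          insert p (insert (g p) (insert a ((T.erase p).erase p'))) := by
        ext x; simp only [mem_insert, mem_erase]; grind
      rw [e] at hb
      rw [e'] at hb'
      have hgpT := hgT p hp
      have hgpa := hga p hp
      have hc : (insert (g p) (insert a ((T.erase p).erase p'))).card = 3 := by
        rw [card_insert_of_notMem (by simp [hgpT, hgpa]),
          card_insert_of_notMem (by simp [haT]),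
          card_erase_of_mem (mem_erase.mpr ⟨Ne.symm hne, hp'⟩), card_erase_of_mem hp]
        omega
      refine hne (huniq _ hc p' p ?_ ?_ hb hb').symm
      · simp only [mem_insert, mem_erase]; grind
      · simp only [mem_insert, mem_erase]; grind
    have hE : (insert a (insert d T) ∪ T.image g).card = 8 := by
      rw [card_union_of_disjoint, card_image_of_injOn hginj,
        card_insert_of_notMem (by simp [had, haT]), card_insert_of_notMem hdT, hT]
      rw [disjoint_right]
      intro x hx
      obtain ⟨p, hp, rfl⟩ := mem_image.mp hx
      simp [hgT p hp, hga p hp, hgd p hp]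
    have himg : bipartiteBelow (fun S a => a ∈ S) G a =
        ((insert a (insert d T) ∪ T.image g)ᶜ).image fun b => insert b (insert a T) := by
      ext S
      simp only [bipartiteBelow, hG, mem_filter, mem_univ, true_and, mem_image, mem_compl,
        mem_union, mem_insert, not_or, not_exists, not_and]
      constructor
      · rintro ⟨⟨h5, hTS, hfree⟩, haS⟩
        have hsub : insert a T ⊆ S := insert_subset haS hTS
        have hc : (S \ insert a T).card = 1 := by
          rw [card_sdiff_of_subset hsub, card_insert_of_notMem haT]; omega
        obtain ⟨b, hb⟩ := card_eq_one.mp hc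
        have hbS : b ∈ S \ insert a T := by rw [hb]; simp
        simp only [mem_sdiff, mem_insert, not_or] at hbS
        have hS : S = insert b (insert a T) := by
          rw [← sdiff_union_of_subset hsub, hb]; rfl
        refine ⟨b, ⟨⟨hbS.2.1, ?_, hbS.2.2⟩, ?_⟩, hS.symm⟩
        · rintro rfl
          refine hfree a haS ?_
          convert hd
          rw [hS]; ext x; simp only [mem_insert, mem_erase]; grind
        · intro p hp h
          refine hfree p (hTS hp) ?_
          convert (hg p hp).2
          rw [hS, h]; ext x; simp only [mem_insert, mem_erase]; grind
      · rintro ⟨b, ⟨⟨hba, hbd, hbT⟩, hbg⟩, rfl⟩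
        refine ⟨⟨?_, ?_, ?_⟩, by simp⟩
        · rw [card_insert_of_notMem (by simp [hba, hbT]), card_insert_of_notMem haT, hT]
        · intro x hx; simp [hx]
        · intro x hx hbl
          rcases mem_insert.mp hx with rfl | hx
          · rw [erase_insert (by simp [hba, hbT])] at hbl
            exact hNa hbl
          rcases mem_insert.mp hx with rfl | hx
          · rw [Finset.insert_comm, erase_insert (by simp [Ne.symm hba, haT])] at hbl
            exact hbd (huniq T hT b d hbT hdT hbl hd)
          · have e : (insert b (insert a T)).erase x = insert b (insert a (T.erase x)) := by
              ext y; simp only [mem_insert, mem_erase]; grind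
            rw [e] at hbl
            exact hbg x hx (huniq _ (hR x hx) _ _ (hg x hx).1 (by simp [hba, hbT])
              (hg x hx).2 hbl)
    rw [himg, card_image_of_injOn, card_compl, hE]
    intro b hb b' hb' hbb
    simp only [coe_compl, Set.mem_compl_iff, mem_coe, mem_union, mem_insert, not_or] at hb hb'
    have : b ∈ insert b' (insert a T) := by
      have h0 : insert b (insert a T) = insert b' (insert a T) := hbb
      rw [← h0]; simp
    simp only [mem_insert] at this
    grind
  rw [sum_congr rfl h1, sum_congr rfl h2] at key
  simp only [sum_const, smul_eq_mul, card_compl, card_insert_of_notMem hdT, hT] at key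
  rw [mul_comm, key]

/-- The columns `(1, x, y, x y)`; for `y = x ^ Q` these represent the tensors `v ⊗ v ^ Q`. -/
def segreMatrix {K : Type*} [Field K] {ι : Type*} (x y : ι → K) : Matrix (Fin 4) ι K :=
  Matrix.of fun r k => ![1, x k, y k, x k * y k] r

lemma det_segreMatrix {K : Type*} [Field K] (x y : Fin 4 → K) :
    (segreMatrix x y).det =
      (x 0 - x 1) * (x 2 - x 3) * ((y 0 - y 2) * (y 1 - y 3)) -
      (x 0 - x 2) * (x 1 - x 3) * ((y 0 - y 1) * (y 2 - y 3)) := by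
  simp [segreMatrix, Matrix.det_succ_row_zero, Fin.sum_univ_succ, Fin.succAbove]
  ring

/-- An element of both `𝔽_{3^i}` and `𝔽_{3^s}` with `i` and `s` coprime lies in `𝔽_3`. -/
lemma pow_three_eq_self {K : Type*} [Field K] {i s : ℕ} (him : Nat.gcd i s = 1) {l : K}
    (h1 : l ^ 3 ^ i = l) (h2 : l ^ 3 ^ s = l) : l ^ 3 = l := by
  have hit : ∀ (n : ℕ) (z : K), (fun z : K => z ^ 3)^[n] z = z ^ 3 ^ n := by
    intro n z
    rw [pow_iterate]
  have p1 : Function.IsPeriodicPt (fun z : K => z ^ 3) i l := (hit i l).trans h1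
  have p2 : Function.IsPeriodicPt (fun z : K => z ^ 3) s l := (hit s l).trans h2
  have := p1.gcd p2
  rw [him] at this
  exact this

/-- The block condition for four distinct `(q+1)`-th roots of unity in characteristic three. -/
lemma det_segreMatrix_eq_zero_iff {K : Type*} [Field K] [CharP K 3] {i s : ℕ}
    (him : Nat.gcd i s = 1) (x : Fin 4 → K) (hx : Function.Injective x)
    (hU : ∀ k, x k ^ (3 ^ s + 1) = 1) :
    (segreMatrix x fun k => x k ^ 3 ^ i).det = 0 ↔
      x 3 * (x 0 + x 1 + x 2) + (x 0 * x 1 + x 0 * x 2 + x 1 * x 2) = 0 := by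
  have : Fact (Nat.Prime 3) := ⟨Nat.prime_three⟩
  have t : (3 : K) = 0 := by exact_mod_cast CharP.cast_eq_zero K 3
  have ex : ∀ a b, a ≠ b → x a - x b ≠ 0 := fun a b hab => sub_ne_zero.mpr (hx.ne hab)
  have n0 : ∀ k, x k ≠ 0 := fun k h => by simpa [h] using hU k
  rw [det_segreMatrix]
  simp only [← sub_pow_char_pow]
  set A := (x 0 - x 1) * (x 2 - x 3) with hA
  set D := (x 0 - x 2) * (x 1 - x 3) with hD
  have hA0 : A ≠ 0 := mul_ne_zero (ex _ _ (by decide)) (ex _ _ (by decide))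
  have hD0 : D ≠ 0 := mul_ne_zero (ex _ _ (by decide)) (ex _ _ (by decide))
  rw [← mul_pow, ← mul_pow, ← hA, ← hD]
  have hconj : ∀ k, x k ^ 3 ^ s = (x k)⁻¹ := fun k =>
    eq_inv_of_mul_eq_one_left (by rw [← pow_succ, hU])
  have hAs : A ^ 3 ^ s = A / (x 0 * x 1 * x 2 * x 3) := by
    have := n0 0; have := n0 1; have := n0 2; have := n0 3
    rw [hA, mul_pow, sub_pow_char_pow, sub_pow_char_pow]
    simp only [hconj]
    field_simp
    ring
  have hDs : D ^ 3 ^ s = D / (x 0 * x 1 * x 2 * x 3) := by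
    have := n0 0; have := n0 1; have := n0 2; have := n0 3
    rw [hD, mul_pow, sub_pow_char_pow, sub_pow_char_pow]
    simp only [hconj]
    field_simp
    ring
  have hs : (A / D) ^ 3 ^ s = A / D := by
    rw [div_pow, hAs, hDs]
    exact div_div_div_cancel_right₀ (by simp [n0]) A D
  have hne : A - D ≠ 0 := by
    have : A - D = - ((x 0 - x 3) * (x 1 - x 2)) := by rw [hA, hD]; ring
    rw [this]
    exact neg_ne_zero.mpr (mul_ne_zero (ex _ _ (by decide)) (ex _ _ (by decide)))
  have hAD : A + D = x 3 * (x 0 + x 1 + x 2) + (x 0 * x 1 + x 0 * x 2 + x 1 * x 2) := by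
    rw [hA, hD]
    linear_combination -(x 0 * x 3 + x 1 * x 2) * t
  rw [← hAD]
  constructor
  · intro h
    have hi : (A / D) ^ 3 ^ i = A / D := by
      rw [div_pow, div_eq_div_iff (pow_ne_zero _ hD0) hD0]
      linear_combination -h
    have h3 := pow_three_eq_self him hi hs
    rw [div_pow, div_eq_div_iff (pow_ne_zero _ hD0) hD0] at h3
    have : A * D * (A - D) * (A + D) = 0 := by linear_combination h3
    simpa [hA0, hD0, hne] using this
  · intro h
    have hA' : A = -D := eq_neg_of_add_eq_zero_left h
    rw [hA', Odd.neg_pow (Odd.pow (by decide))]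
    ring

lemma existsUnique_fourth_point {K : Type*} [Field K] [CharP K 3] {s : ℕ}
    (x : Fin 3 → K) (hx : Function.Injective x) (hU : ∀ k, x k ^ (3 ^ s + 1) = 1) :
    ∃ z, (z ^ (3 ^ s + 1) = 1 ∧ (∀ k, z ≠ x k)) ∧
      ∀ z', z' * (x 0 + x 1 + x 2) + (x 0 * x 1 + x 0 * x 2 + x 1 * x 2) = 0 ↔ z' = z := by
  have : Fact (Nat.Prime 3) := ⟨Nat.prime_three⟩
  have t : (3 : K) = 0 := by exact_mod_cast CharP.cast_eq_zero K 3
  have ex : ∀ a b, a ≠ b → x a - x b ≠ 0 := fun a b hab => sub_ne_zero.mpr (hx.ne hab)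
  have n0 : ∀ k, x k ≠ 0 := fun k h => by simpa [h] using hU k
  have hconj : ∀ k, x k ^ 3 ^ s = (x k)⁻¹ := fun k =>
    eq_inv_of_mul_eq_one_left (by rw [← pow_succ, hU])
  set e := x 0 + x 1 + x 2 with he
  set f := x 0 * x 1 + x 0 * x 2 + x 1 * x 2 with hf
  have hes : e ^ 3 ^ s = f / (x 0 * x 1 * x 2) := by
    have := n0 0; have := n0 1; have := n0 2
    rw [he, add_pow_char_pow, add_pow_char_pow, hf]
    simp only [hconj]
    field_simp
    ring
  have hfs : f ^ 3 ^ s = e / (x 0 * x 1 * x 2) := by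
    have := n0 0; have := n0 1; have := n0 2
    rw [hf, add_pow_char_pow, add_pow_char_pow, he]
    simp only [mul_pow, hconj]
    field_simp
    ring
  have hk : ∀ a b c, e = x a + x b + x c → f = x a * x b + x a * x c + x b * x c →
      x a * e + f = (x a - x b) * (x a - x c) := fun a b c h1 h2 => by
    rw [h1, h2]; linear_combination (x a * x b + x a * x c) * t
  have k0 := hk 0 1 2 he hf
  have k1 := hk 1 0 2 (by rw [he]; ring) (by rw [hf]; ring)
  have k2 := hk 2 0 1 (by rw [he]; ring) (by rw [hf]; ring)
  have hkne : ∀ k, x k * e + f ≠ 0 := by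
    intro k
    fin_cases k
    · exact k0 ▸ mul_ne_zero (ex _ _ (by decide)) (ex _ _ (by decide))
    · exact k1 ▸ mul_ne_zero (ex _ _ (by decide)) (ex _ _ (by decide))
    · exact k2 ▸ mul_ne_zero (ex _ _ (by decide)) (ex _ _ (by decide))
  have he0 : e ≠ 0 := by
    intro h
    have : f = 0 := by
      rw [h, zero_pow (by positivity), eq_comm, div_eq_zero_iff] at hes
      simpa [n0] using hes
    exact hkne 0 (by rw [h, this]; ring)
  have hf0 : f ≠ 0 := by
    intro h
    rw [h, zero_pow (by positivity), eq_comm, div_eq_zero_iff] at hfs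
    simp [n0, he0] at hfs
  refine ⟨-f / e, ⟨?_, ?_⟩, ?_⟩
  · rw [pow_succ, div_pow, Odd.neg_pow (Odd.pow (by decide)), hes, hfs]
    have := n0 0; have := n0 1; have := n0 2
    field_simp
  · intro k h
    apply hkne k
    rw [← h]; field_simp; ring
  · intro z'
    rw [eq_div_iff he0, eq_neg_iff_add_eq_zero]

lemma segreMatrix_mulVec_eq_zero_iff {K ι : Type*} [Field K] [Fintype ι] (x y w : ι → K) :
    (segreMatrix x y).mulVec w = 0 ↔ ∑ j, w j = 0 ∧ ∑ j, w j * x j = 0 ∧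
      ∑ j, w j * y j = 0 ∧ ∑ j, w j * (x j * y j) = 0 := by
  rw [funext_iff, Fin.forall_fin_succ, Fin.forall_fin_succ, Fin.forall_fin_succ,
    Fin.forall_fin_succ]
  simp [segreMatrix, Matrix.mulVec, dotProduct, mul_comm]

lemma segreMatrix_restrict {K J : Type*} [Field K] [Fintype J] [DecidableEq J] (x y : J → K)
    {n : ℕ} (p : Fin n → J) (hp : Function.Injective p) (S : Finset J)
    (hS : ∀ j, j ∈ S ↔ ∃ k, p k = j) :
    (∃ w : J → K, (segreMatrix x y).mulVec w = 0 ∧ w ≠ 0 ∧ ∀ j ∉ S, w j = 0) ↔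
      ∃ v : Fin n → K, v ≠ 0 ∧ (segreMatrix (x ∘ p) (y ∘ p)).mulVec v = 0 := by
  have hsum : ∀ (w : J → K), (∀ j ∉ S, w j = 0) →
      (segreMatrix (x ∘ p) (y ∘ p)).mulVec (w ∘ p) = (segreMatrix x y).mulVec w := by
    intro w hw
    ext r
    simp only [Matrix.mulVec, dotProduct]
    have hS' : S = Finset.univ.image p := by ext j; simp [hS]
    rw [← Finset.sum_subset (Finset.subset_univ S) (fun j _ hj => by rw [hw j hj, mul_zero]),
      hS', Finset.sum_image hp.injOn]
    rfl
  constructor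
  · rintro ⟨w, hw, hw0, hws⟩
    refine ⟨w ∘ p, ?_, (hsum w hws).trans hw⟩
    contrapose! hw0
    ext j
    by_cases hj : j ∈ S
    · obtain ⟨k, rfl⟩ := (hS j).mp hj
      exact congrFun hw0 k
    · exact hws j hj
  · rintro ⟨v, hv0, hv⟩
    have hvp : Function.extend p v 0 ∘ p = v := Function.extend_comp hp v 0
    have hsupp : ∀ j ∉ S, Function.extend p v 0 j = 0 := fun j hj => by
      rw [Function.extend_apply' _ _ _ (fun h => hj ((hS j).mpr h))]; rfl
    refine ⟨Function.extend p v 0, ?_, ?_, hsupp⟩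
    · rw [← hsum _ hsupp, hvp, hv]
    · intro h
      rw [h] at hvp
      exact hv0 (hvp ▸ rfl)

lemma sum_mul_pow_conj {K J : Type*} [Field K] [CharP K 3] [Fintype J] {s : ℕ}
    (a : J → K) (hU : ∀ j, a j ^ (3 ^ s + 1) = 1) {e f : ℕ} (hef : e + f = 3 ^ s + 1)
    (W : J → K) : (∑ j, W j * a j ^ e) ^ 3 ^ s = ∑ j, W j ^ 3 ^ s * a j ^ f := by
  have : Fact (Nat.Prime 3) := ⟨Nat.prime_three⟩
  rw [sum_pow_char_pow]
  refine Finset.sum_congr rfl fun j _ => ?_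
  have hj : a j ^ e ≠ 0 := pow_ne_zero _ fun h => by simpa [h] using hU j
  rw [mul_pow]
  congr 1
  apply mul_right_cancel₀ hj
  rw [← pow_succ, ← pow_mul, mul_comm e, pow_mul, hU, one_pow, ← pow_add, add_comm f, hef, hU]

lemma exists_shift {K J : Type*} [Field K] [Fintype J] {s i h : ℕ} (his : i < s)
    (hh : 2 * h = 3 ^ s - 3 ^ i ∨ 2 * h = 3 ^ i - 1)
    (a : J → K) (hU : ∀ j, a j ^ (3 ^ s + 1) = 1) :
    ∃ m, ∀ W : J → K,
      (segreMatrix a fun j => a j ^ 3 ^ i).mulVec (fun j => W j * a j ^ m) = 0 ↔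
        (∑ j, W j * a j ^ h = 0 ∧ ∑ j, W j * a j ^ (h + 1) = 0) ∧
        ∑ j, W j * a j ^ (3 ^ s - h) = 0 ∧ ∑ j, W j * a j ^ (3 ^ s + 1 - h) = 0 := by
  have hlt : 3 ^ i < 3 ^ s := Nat.pow_lt_pow_right (by norm_num) his
  have hpos : 0 < 3 ^ i := by positivity
  simp only [segreMatrix_mulVec_eq_zero_iff, mul_assoc, ← pow_succ, ← pow_succ', ← pow_add]
  rcases hh with hh | hh
  · refine ⟨h, fun W => ?_⟩
    rw [show h + 3 ^ i = 3 ^ s - h by omega, show h + (3 ^ i + 1) = 3 ^ s + 1 - h by omega]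
    tauto
  · refine ⟨3 ^ s - h, fun W => ?_⟩
    rw [show 3 ^ s - h + 3 ^ i = 3 ^ s + 1 + h by omega,
      show 3 ^ s - h + (3 ^ i + 1) = 3 ^ s + 1 + (h + 1) by omega,
      show 3 ^ s - h + 1 = 3 ^ s + 1 - h by omega]
    simp only [pow_add _ (3 ^ s + 1), hU, one_mul]
    tauto

/-- Words over the subfield exist on a support exactly when words over the big field do. -/
lemma exists_subfield_word_iff {F K J : Type*} [Field F] [Field K] [Fintype F] [Fintype K]
    [Algebra F K] [CharP K 3] [Fintype J] {s i h : ℕ}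
    (hF : Fintype.card F = 3 ^ s) (hK : Fintype.card K = (3 ^ s) ^ 2) (his : i < s)
    (hh : 2 * h = 3 ^ s - 3 ^ i ∨ 2 * h = 3 ^ i - 1)
    (a : J → K) (hU : ∀ j, a j ^ (3 ^ s + 1) = 1) (S : Finset J) :
    (∃ c : J → F, (∑ j, algebraMap F K (c j) * a j ^ h = 0 ∧
        ∑ j, algebraMap F K (c j) * a j ^ (h + 1) = 0) ∧ c ≠ 0 ∧ ∀ j ∉ S, c j = 0) ↔
      ∃ w : J → K, (segreMatrix a fun j => a j ^ 3 ^ i).mulVec w = 0 ∧ w ≠ 0 ∧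
        ∀ j ∉ S, w j = 0 := by
  have : Fact (Nat.Prime 3) := ⟨Nat.prime_three⟩
  have hlt : h < 3 ^ s := by
    have : 0 < 3 ^ i := by positivity
    have : 3 ^ i < 3 ^ s := Nat.pow_lt_pow_right (by norm_num) his
    omega
  have ha : ∀ j, a j ≠ 0 := fun j h => by simpa [h] using hU j
  have hq0 : 3 ^ s ≠ 0 := by positivity
  obtain ⟨m, hm⟩ := exists_shift his hh a hU
  constructor
  · rintro ⟨c, ⟨h1, h2⟩, hc0, hcS⟩
    have hc : ∀ j, algebraMap F K (c j) ^ 3 ^ s = algebraMap F K (c j) := fun j => by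
      rw [← map_pow, ← hF, FiniteField.pow_card]
    have e1 := sum_mul_pow_conj a hU (e := h) (f := 3 ^ s + 1 - h) (by omega)
      fun j => algebraMap F K (c j)
    have e2 := sum_mul_pow_conj a hU (e := h + 1) (f := 3 ^ s - h) (by omega)
      fun j => algebraMap F K (c j)
    rw [h1, zero_pow hq0] at e1
    rw [h2, zero_pow hq0] at e2
    simp only [hc] at e1 e2
    refine ⟨_, (hm _).mpr ⟨⟨h1, h2⟩, e2.symm, e1.symm⟩, ?_, fun j hj => by simp [hcS j hj]⟩
    contrapose! hc0
    ext j
    simpa [ha j] using congrFun hc0 j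
  · rintro ⟨w, hw, hw0, hwS⟩
    obtain ⟨k, hk⟩ := Function.ne_iff.mp hw0
    have hk : w k ≠ 0 := hk
    set d : J → K := fun j => (a k ^ m / w k) * (w j * (a j ^ m)⁻¹) with hd
    have hdk : d k = 1 := by
      have := pow_ne_zero m (ha k)
      simp only [hd]; field_simp
    have hd4 := (hm d).mp (by
      have : (fun j => d j * a j ^ m) = (a k ^ m / w k) • w := by
        ext j
        have := pow_ne_zero m (ha j)
        simp only [hd, Pi.smul_apply, smul_eq_mul]; field_simp
      rw [this, Matrix.mulVec_smul, hw, smul_zero])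
    obtain ⟨⟨d1, d2⟩, d3, d4⟩ := hd4
    have hfr : Module.finrank F K = 2 := by
      have := Module.card_eq_pow_finrank (K := F) (V := K)
      rw [hF, hK] at this
      refine (Nat.pow_right_injective (hF ▸ Fintype.one_lt_card) this).symm
    have htr : ∀ j, algebraMap F K (Algebra.trace F K (d j)) = d j + d j ^ 3 ^ s := fun j => by
      rw [FiniteField.algebraMap_trace_eq_sum_pow, hfr, Finset.sum_range_succ,
        Finset.sum_range_one, Nat.card_eq_fintype_card, hF]
      simp
    have e1 := sum_mul_pow_conj a hU (e := 3 ^ s + 1 - h) (f := h) (by omega) d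
    have e2 := sum_mul_pow_conj a hU (e := 3 ^ s - h) (f := h + 1) (by omega) d
    rw [d4, zero_pow hq0] at e1
    rw [d3, zero_pow hq0] at e2
    refine ⟨fun j => Algebra.trace F K (d j), ⟨?_, ?_⟩, ?_, ?_⟩
    · simp only [htr, add_mul, Finset.sum_add_distrib, d1, ← e1, add_zero]
    · simp only [htr, add_mul, Finset.sum_add_distrib, d2, ← e2, add_zero]
    · intro h0
      have h1 := htr k
      rw [show Algebra.trace F K (d k) = 0 from congrFun h0 k, hdk, map_zero, one_pow] at h1
      have t : (3 : K) = 0 := by exact_mod_cast CharP.cast_eq_zero K 3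
      exact one_ne_zero (α := K) (by linear_combination t + h1)
    · intro j hj
      simp [hd, hwS j hj]

open Finset in
lemma exists_support_eq_iff {F J : Type*} [Field F] [DecidableEq F] [Fintype J] [DecidableEq J]
    (C : Set (J → F)) (hC : ∀ c ∈ C, ∀ c' ∈ C, ∀ t : F, c - t • c' ∈ C)
    (B : Finset J → Prop) (hBdef : ∀ S, B S ↔ ∃ c ∈ C, c ≠ 0 ∧ ∀ j ∉ S, c j = 0)
    (hB : ∀ T : Finset J, T.card = 3 → ∃! x, x ∉ T ∧ B (insert x T))
    (h5 : ∀ S : Finset J, S.card = 5 → B S) (S : Finset J) (hS : S.card = 5) :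
    (∃ c ∈ C, (univ.filter fun j => c j ≠ 0) = S) ↔ ∀ x ∈ S, ¬ B (S.erase x) := by
  constructor
  · rintro ⟨c, hc, hcS⟩ x hx hb
    have hcS' : ∀ j, c j ≠ 0 ↔ j ∈ S := fun j => by rw [← hcS]; simp
    obtain ⟨c', hc', hne, hsupp⟩ := (hBdef _).mp hb
    obtain ⟨y, hy⟩ := Function.ne_iff.mp hne
    have hy : c' y ≠ 0 := hy
    have hyS : y ∈ S.erase x := by
      by_contra h
      exact hy (hsupp y h)
    obtain ⟨hyx, hyS⟩ := mem_erase.mp hyS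
    have hb' : B (S.erase y) := by
      refine (hBdef _).mpr ⟨_, hC c hc c' hc' (c y / c' y), ?_, ?_⟩
      · intro h0
        have hcx := congrFun h0 x
        have : c' x = 0 := hsupp x (by simp)
        simp only [Pi.sub_apply, Pi.smul_apply, this, smul_zero, sub_zero] at hcx
        exact (hcS' x).mpr hx hcx
      · intro j hj
        by_cases hjy : j = y
        · subst hjy
          simp [hy]
        · have hjS : j ∉ S := fun h => hj (mem_erase.mpr ⟨hjy, h⟩)
          have h1 : c j = 0 := not_not.mp fun h => hjS ((hcS' j).mp h)
          have h2 : c' j = 0 := hsupp j fun h => hjS (mem_of_mem_erase h)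
          simp [h1, h2]
    have hR : ((S.erase x).erase y).card = 3 := by
      rw [card_erase_of_mem (mem_erase.mpr ⟨hyx, hyS⟩), card_erase_of_mem hx, hS]
    refine hyx ((hB _ hR).unique ⟨by simp, ?_⟩ ⟨by simp, ?_⟩)
    · rwa [insert_erase (mem_erase.mpr ⟨hyx, hyS⟩)]
    · rwa [erase_right_comm, insert_erase (mem_erase.mpr ⟨hyx.symm, hx⟩)]
  · intro h
    obtain ⟨c, hc, hne, hsupp⟩ := (hBdef S).mp (h5 S hS)
    refine ⟨c, hc, ?_⟩
    ext j
    simp only [mem_filter, mem_univ, true_and]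
    constructor
    · intro hj
      by_contra hjS
      exact hj (hsupp j hjS)
    · intro hj h0
      refine h j hj ((hBdef _).mpr ⟨c, hc, hne, fun k hk => ?_⟩)
      by_cases hkj : k = j
      · rw [hkj, h0]
      · exact hsupp k fun h => hk (mem_erase.mpr ⟨hkj, h⟩)

lemma exists_segre_relation_of_card_eq_five {K J : Type*} [Field K] [Fintype J] [DecidableEq J]
    (x y : J → K) (S : Finset J) (hS : S.card = 5) :
    ∃ w : J → K, (segreMatrix x y).mulVec w = 0 ∧ w ≠ 0 ∧ ∀ j ∉ S, w j = 0 := by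
  let e := S.equivFinOfCardEq hS
  rw [segreMatrix_restrict x y (fun k => (e.symm k : J))
    (Subtype.val_injective.comp e.symm.injective) S
    fun j => ⟨fun h => ⟨e ⟨j, h⟩, by simp⟩, by rintro ⟨k, rfl⟩; exact (e.symm k).2⟩]
  have := LinearMap.ker_ne_bot_of_finrank_lt
    (f := (segreMatrix (x ∘ fun k => (e.symm k : J)) (y ∘ fun k => (e.symm k : J))).mulVecLin)
    (by simp)
  obtain ⟨v, hv, hv0⟩ := Submodule.exists_mem_ne_zero_of_ne_bot this
  exact ⟨v, hv0, hv⟩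

lemma existsUnique_segre_relation {K J : Type*} [Field K] [CharP K 3] [Fintype J]
    [DecidableEq J] {i s : ℕ} (him : Nat.gcd i s = 1) (a : J → K) (ha : Function.Injective a)
    (hU : ∀ j, a j ^ (3 ^ s + 1) = 1) (hsurj : ∀ z, z ^ (3 ^ s + 1) = 1 → ∃ j, a j = z)
    (T : Finset J) (hT : T.card = 3) :
    ∃! x, x ∉ T ∧ ∃ w : J → K, (segreMatrix a fun j => a j ^ 3 ^ i).mulVec w = 0 ∧ w ≠ 0 ∧
      ∀ j ∉ insert x T, w j = 0 := by
  obtain ⟨p0, p1, p2, h01, h02, h12, rfl⟩ := Finset.card_eq_three.mp hT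
  have key : ∀ p3, p3 ∉ ({p0, p1, p2} : Finset J) →
      ((∃ w : J → K, (segreMatrix a fun j => a j ^ 3 ^ i).mulVec w = 0 ∧ w ≠ 0 ∧
        ∀ j ∉ insert p3 ({p0, p1, p2} : Finset J), w j = 0) ↔
      a p3 * (a p0 + a p1 + a p2) + (a p0 * a p1 + a p0 * a p2 + a p1 * a p2) = 0) := by
    intro p3 hp3
    simp only [Finset.mem_insert, Finset.mem_singleton, not_or] at hp3
    obtain ⟨h30, h31, h32⟩ := hp3
    have hp : Function.Injective ![p0, p1, p2, p3] := by
      intro k l hkl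
      fin_cases k <;> fin_cases l <;> simp_all
    rw [segreMatrix_restrict a _ ![p0, p1, p2, p3] hp _ (by
      intro j
      simp [Fin.exists_fin_succ]
      grind), Matrix.exists_mulVec_eq_zero_iff]
    exact det_segreMatrix_eq_zero_iff him (a ∘ ![p0, p1, p2, p3]) (ha.comp hp) fun k => hU _
  have hp : Function.Injective ![p0, p1, p2] := by
    intro k l hkl
    fin_cases k <;> fin_cases l <;> simp_all
  obtain ⟨z, ⟨hz, hzne⟩, hzu⟩ :=
    existsUnique_fourth_point (s := s) (a ∘ ![p0, p1, p2]) (ha.comp hp) fun k => hU _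
  obtain ⟨p3, rfl⟩ := hsurj z hz
  have hp3 : p3 ∉ ({p0, p1, p2} : Finset J) := by
    simp only [Finset.mem_insert, Finset.mem_singleton, not_or]
    exact ⟨fun h => hzne 0 (by simp [h]), fun h => hzne 1 (by simp [h]),
      fun h => hzne 2 (by simp [h])⟩
  refine ⟨p3, ⟨hp3, (key p3 hp3).mpr ((hzu _).mpr rfl)⟩, ?_⟩
  rintro x ⟨hx, hw⟩
  exact ha ((hzu _).mp ((key x hx).mp hw))

theorem stmt15 (s : ℕ) (hs : 1 < s) (q : ℕ) (hq : q = 3 ^ s)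
    (i : ℕ) (hi0 : 0 < i) (his : i < s) (him : Nat.gcd i s = 1)
    (h : ℕ) (hh : 2 * h = q - 3 ^ i ∨ 2 * h = 3 ^ i - 1)
    (F K : Type) [Field F] [Field K] [Fintype F] [Fintype K] [DecidableEq F]
    [Algebra F K] (hF : Fintype.card F = q) (hK : Fintype.card K = q ^ 2)
    (β : K) (hβ : IsPrimitiveRoot β (q + 1))
    (C : Set (Fin (q + 1) → F))
    (hC : C = {c | (∑ j : Fin (q + 1), algebraMap F K (c j) * β ^ (h * (j : ℕ)) = 0) ∧
      (∑ j : Fin (q + 1), algebraMap F K (c j) * β ^ ((h + 1) * (j : ℕ)) = 0)}) :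
    ∀ T : Finset (Fin (q + 1)), T.card = 3 →
      2 * {S : Finset (Fin (q + 1)) | S.card = 5 ∧ T ⊆ S ∧
        ∃ c ∈ C, (Finset.univ.filter fun j => c j ≠ 0) = S}.ncard =
      (q - 3) * (q - 7) := by
  classical
  intro T hT
  subst hq
  have : Fact (Nat.Prime 3) := ⟨Nat.prime_three⟩
  have : CharP K 3 := charP_of_card_eq_prime_pow (f := s * 2) (by rw [hK, ← pow_mul])
  set a : Fin (3 ^ s + 1) → K := fun j => β ^ (j : ℕ) with ha_def
  have hU : ∀ j, a j ^ (3 ^ s + 1) = 1 := fun j => by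
    rw [ha_def, ← pow_mul, mul_comm, pow_mul, hβ.pow_eq_one, one_pow]
  have ha : Function.Injective a := fun j k hjk =>
    Fin.ext (hβ.pow_inj j.isLt k.isLt hjk)
  have hsurj : ∀ z, z ^ (3 ^ s + 1) = 1 → ∃ j, a j = z := fun z hz => by
    obtain ⟨n, hn, rfl⟩ := hβ.eq_pow_of_pow_eq_one hz
    exact ⟨⟨n, hn⟩, rfl⟩
  simp only [mul_comm _ (Fin.val _), pow_mul] at hC
  set B : Finset (Fin (3 ^ s + 1)) → Prop := fun S =>
    ∃ w : Fin (3 ^ s + 1) → K, (segreMatrix a fun j => a j ^ 3 ^ i).mulVec w = 0 ∧ w ≠ 0 ∧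
      ∀ j ∉ S, w j = 0
  have hB := existsUnique_segre_relation him a ha hU hsurj
  have hsub : ∀ c ∈ C, ∀ c' ∈ C, ∀ t : F, c - t • c' ∈ C := by
    rw [hC]
    rintro c ⟨h1, h2⟩ c' ⟨h1', h2'⟩ t
    constructor <;>
      simp only [Pi.sub_apply, Pi.smul_apply, smul_eq_mul, map_sub, map_mul, sub_mul, mul_assoc,
        Finset.sum_sub_distrib, ← Finset.mul_sum, h1, h2, h1', h2', mul_zero, sub_zero]
  have hsupp := exists_support_eq_iff C hsub B
    (fun S => by
      rw [hC]
      exact (exists_subfield_word_iff hF hK his hh a hU S).symm) hB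
    (exists_segre_relation_of_card_eq_five _ _)
  have hcount := two_mul_card_blockFree B hB T hT
  rw [Fintype.card_fin] at hcount
  rw [show 3 ^ s - 3 = 3 ^ s + 1 - 4 by omega, show 3 ^ s - 7 = 3 ^ s + 1 - 8 by omega, ← hcount,
    ← Set.ncard_coe_finset]
  congr 2
  ext S
  simp only [Set.mem_ofPred_eq, Finset.coe_filter, Finset.mem_univ, true_and]
  exact and_congr_right fun h5 => and_congr_right fun _ => hsupp S h5
end

section
/- Let q = 2^s with s ≥ 4 an integer, and let h = q/4 = 2^{s−2}. Then the binary subfield subcode B_h = {(c_0,…,c_q) ∈ F_2^{q+1} : ∑_{j=0}^q c_j β^{hj} = 0 and ∑_{j=0}^q c_j β^{(h+1)j} = 0} has F_2-dimension q + 1 − 4s (i.e., it contains exactly 2^{q+1−4s} codewords), and its minimum distance is at least 5. -/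
/-- The elements `1` and `3` lie in distinct cyclotomic cosets modulo `2 ^ s + 1`, and both cosets
have size `2 * s`. -/
lemma cyclotomicCoset_one_three_mod_two_pow_add_one {s k a b : ℕ} (hs : 4 ≤ s) (hk : k < 2 * s)
    (ha : a = 1 ∨ a = 3) (hb : b = 1 ∨ b = 3)
    (hdvd : ((2 : ℤ) ^ s + 1) ∣ (b : ℤ) * 2 ^ k - a) : k = 0 ∧ a = b := by
  have hQ : (16 : ℤ) ∣ 2 ^ s ∧ (0 : ℤ) < 2 ^ s :=
    ⟨by simpa using pow_dvd_pow (2 : ℤ) hs, by positivity⟩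
  have key : ∀ m : ℕ, m < s → 2 * (2 : ℤ) ^ m ≤ 2 ^ s ∧ (0 : ℤ) < 2 ^ m ∧
      ((2 : ℤ) ^ m = 1 ∧ m = 0 ∨ (2 : ℤ) ^ m = 2 ∨ (2 : ℤ) ^ m = 4 ∨ (8 : ℤ) ∣ 2 ^ m) := by
    intro m hm
    refine ⟨?_, by positivity, ?_⟩
    · rw [← pow_succ']
      exact pow_le_pow_right₀ (by norm_num) hm
    · rcases lt_or_ge m 3 with h3 | h3
      · interval_cases m <;> simp
      · right; right; right
        simpa using pow_dvd_pow (2 : ℤ) h3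
  have h3 : ¬ (3 : ℤ) ∣ 2 ^ s := fun h => by
    have := Int.prime_three.dvd_of_dvd_pow h
    norm_num at this
  obtain ⟨h16, hpos⟩ := hQ
  rcases lt_or_ge k s with hks | hks
  · obtain ⟨hle, ht, hcases⟩ := key k hks
    obtain ⟨c, hc⟩ := hdvd
    generalize (2 : ℤ) ^ k = t at *
    generalize (2 : ℤ) ^ s = Q at *
    have hc2 : c < 2 := by
      by_contra! hcon
      have : (Q + 1) * 2 ≤ (Q + 1) * c := by gcongr
      rcases ha with rfl | rfl <;> rcases hb with rfl | rfl <;> push_cast at * <;> omega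
    have hc0 : -1 < c := by
      by_contra! hcon
      have : (Q + 1) * c ≤ (Q + 1) * (-1) := by gcongr
      rcases ha with rfl | rfl <;> rcases hb with rfl | rfl <;> push_cast at * <;> omega
    have : c = 0 ∨ c = 1 := by omega
    rcases this with rfl | rfl <;>
    rcases ha with rfl | rfl <;> rcases hb with rfl | rfl <;> push_cast at hc <;> omega
  · obtain ⟨hle, ht, hcases⟩ := key (k - s) (by omega)
    have hsplit : (2 : ℤ) ^ k = 2 ^ (k - s) * 2 ^ s := (pow_sub_mul_pow (2 : ℤ) hks).symm
    rw [hsplit] at hdvd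
    have hdvd' : ((2 : ℤ) ^ s + 1) ∣ (b : ℤ) * 2 ^ (k - s) + a := by
      have h2 : ((2 : ℤ) ^ s + 1) ∣ (2 ^ s + 1) * ((b : ℤ) * 2 ^ (k - s)) := dvd_mul_right _ _
      have := dvd_sub h2 hdvd
      ring_nf at this ⊢
      exact this
    obtain ⟨c, hc⟩ := hdvd'
    generalize (2 : ℤ) ^ (k - s) = t at *
    generalize (2 : ℤ) ^ s = Q at *
    have hc2 : c < 2 := by
      by_contra! hcon
      have : (Q + 1) * 2 ≤ (Q + 1) * c := by gcongr
      rcases ha with rfl | rfl <;> rcases hb with rfl | rfl <;> push_cast at * <;> omega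
    have hc0 : 0 < c := by
      by_contra! hcon
      have : (Q + 1) * c ≤ (Q + 1) * 0 := by gcongr
      rcases ha with rfl | rfl <;> rcases hb with rfl | rfl <;> push_cast at * <;> omega
    obtain rfl : c = 1 := by omega
    rcases ha with rfl | rfl <;> rcases hb with rfl | rfl <;> push_cast at * <;> omega

lemma IsPrimitiveRoot.injective_pow_mul_two_pow {K : Type*} [Field K] [CharP K 2] {s : ℕ}
    (hs : 4 ≤ s) {β : K} (hβ : IsPrimitiveRoot β (2 ^ s + 1)) {a b i j : ℕ}
    (ha : a = 1 ∨ a = 3) (hb : b = 1 ∨ b = 3) (hi : i < 2 * s) (hj : j < 2 * s)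
    (heq : β ^ (a * 2 ^ i) = β ^ (b * 2 ^ j)) : a = b ∧ i = j := by
  wlog hij : i ≤ j generalizing a b i j
  · have := this hb ha hj hi heq.symm (by omega)
    exact ⟨this.1.symm, this.2.symm⟩
  have h1 : β ^ a = β ^ (b * 2 ^ (j - i)) := by
    apply iterateFrobenius_inj K 2 i
    simp only [iterateFrobenius_def, ← pow_mul, heq, mul_assoc, pow_sub_mul_pow 2 hij]
  have h2 : ((2 : ℤ) ^ s + 1) ∣ (b : ℤ) * 2 ^ (j - i) - a := by
    have h3 : β ^ ((b : ℤ) * 2 ^ (j - i) - a) = 1 := by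
      rw [zpow_sub₀ (hβ.ne_zero (by positivity)), div_eq_one_iff_eq
        (zpow_ne_zero _ (hβ.ne_zero (by positivity)))]
      exact_mod_cast h1.symm
    exact_mod_cast (hβ.zpow_eq_one_iff_dvd _).1 h3
  have := cyclotomicCoset_one_three_mod_two_pow_add_one hs (by omega) ha hb h2
  exact ⟨this.2, by omega⟩

/-- The geometric progressions with ratios in an injective family are linearly independent. -/
lemma eq_zero_of_sum_mul_pow_eq_zero {ι K : Type*} [Fintype ι] [Field K] {x : ι → K}
    (hx : Function.Injective x) {a : ι → K} (h : ∀ n : ℕ, ∑ i, a i * x i ^ n = 0) (i : ι) :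
    a i = 0 := by
  have hli := (linearIndependent_monoidHom (Multiplicative ℕ) K).comp
    (fun i => powersHom K (x i)) ((powersHom K).injective.comp hx)
  refine Fintype.linearIndependent_iff.1 hli a ?_ i
  ext n
  simpa [powersHom_apply] using h n.toAdd

/-- Every linear functional on a finite field of characteristic two is given by the trace form. -/
lemma exists_dual_eq_sum_pow {K : Type*} [Field K] [Finite K] [Algebra (ZMod 2) K]
    (f : Module.Dual (ZMod 2) K) : ∃ a : K, ∀ u : K, algebraMap (ZMod 2) K (f u) =
      ∑ i ∈ Finset.range (Module.finrank (ZMod 2) K), (a * u) ^ 2 ^ i := by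
  have : FiniteDimensional (ZMod 2) K := Module.Finite.of_finite
  have hnd := traceForm_nondegenerate (ZMod 2) K
  refine ⟨((Algebra.traceForm (ZMod 2) K).toDual hnd).symm f, fun u => ?_⟩
  have h1 := LinearMap.BilinForm.toDual_def hnd
    (m := ((Algebra.traceForm (ZMod 2) K).toDual hnd).symm f) (n := u)
  rw [LinearEquiv.apply_symm_apply, Algebra.traceForm_apply] at h1
  rw [h1, FiniteField.algebraMap_trace_eq_sum_pow, Nat.card_zmod]

/-- The syndrome map of the binary cyclic code of length `n` with zeros `β` and `β ^ 3`. -/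
noncomputable def syndromeMap {K : Type*} [Field K] [Algebra (ZMod 2) K] (n : ℕ) (β : K) :
    (Fin n → ZMod 2) →ₗ[ZMod 2] K × K :=
  Fintype.linearCombination (ZMod 2) fun j : Fin n => (β ^ (j : ℕ), β ^ (3 * (j : ℕ)))

lemma syndromeMap_surjective {K : Type*} [Field K] [Finite K] [Algebra (ZMod 2) K] {s : ℕ}
    (hs : 4 ≤ s) (hd : Module.finrank (ZMod 2) K = 2 * s) {β : K}
    (hβ : IsPrimitiveRoot β (2 ^ s + 1)) : Function.Surjective (syndromeMap (2 ^ s + 1) β) := by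
  have : CharP K 2 := charP_of_injective_algebraMap (algebraMap (ZMod 2) K).injective 2
  rw [← LinearMap.range_eq_top]
  by_contra hne
  obtain ⟨f, hf, hle⟩ := Submodule.exists_le_ker_of_lt_top _ (lt_top_iff_ne_top.2 hne)
  obtain ⟨a, ha⟩ := exists_dual_eq_sum_pow (f.comp (LinearMap.inl (ZMod 2) K K))
  obtain ⟨b, hb⟩ := exists_dual_eq_sum_pow (f.comp (LinearMap.inr (ZMod 2) K K))
  have hfuv (u v : K) : f (u, v) = f (u, 0) + f (0, v) := by rw [← map_add]; simp
  simp only [hd, LinearMap.comp_apply, LinearMap.inl_apply, LinearMap.inr_apply] at ha hb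
  have hβ1 (n : ℕ) : f (β ^ n, β ^ (3 * n)) = 0 := by
    have h1 : (β ^ n, β ^ (3 * n)) ∈ LinearMap.range (syndromeMap (2 ^ s + 1) β) := by
      refine ⟨Pi.single ⟨n % (2 ^ s + 1), Nat.mod_lt _ (by positivity)⟩ 1, ?_⟩
      have h2 : β ^ (n % (2 ^ s + 1)) = β ^ n := by
        conv_rhs => rw [pow_eq_pow_mod n hβ.pow_eq_one]
      rw [syndromeMap, Fintype.linearCombination_apply_single, one_smul, mul_comm 3, pow_mul, h2,
        ← pow_mul, mul_comm n]
    exact hle h1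
  let x : Bool × Fin (2 * s) → K := fun p => β ^ ((if p.1 then 1 else 3) * 2 ^ (p.2 : ℕ))
  let y : Bool × Fin (2 * s) → K := fun p => (if p.1 then a else b) ^ 2 ^ (p.2 : ℕ)
  have hx : Function.Injective x := by
    rintro ⟨e, i⟩ ⟨e', i'⟩ h
    have := hβ.injective_pow_mul_two_pow hs (by cases e <;> simp) (by cases e' <;> simp)
      i.2 i'.2 h
    ext
    · have he := this.1
      cases e <;> cases e' <;> simp at he ⊢
    · exact this.2
  have hy : ∀ p, y p = 0 := by
    refine eq_zero_of_sum_mul_pow_eq_zero hx fun n => ?_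
    have h1 := congrArg (algebraMap (ZMod 2) K) (hβ1 n)
    rw [hfuv, map_add, ha, hb, map_zero, Finset.sum_range, Finset.sum_range] at h1
    rw [Fintype.sum_prod_type, Fintype.sum_bool, ← h1]
    congr 1 <;> refine Finset.sum_congr rfl fun i _ => ?_
    · simp only [x, y, if_true, mul_pow, ← pow_mul]
      congr 2; ring
    · simp only [x, y, Bool.false_eq_true, if_false, mul_pow, ← pow_mul]
      congr 2; ring
  have ha0 : a = 0 := by simpa [y] using hy (true, ⟨0, by omega⟩)
  have hb0 : b = 0 := by simpa [y] using hy (false, ⟨0, by omega⟩)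
  apply hf
  ext u
  · apply (algebraMap (ZMod 2) K).injective
    simpa [ha0] using ha u
  · apply (algebraMap (ZMod 2) K).injective
    simpa [hb0] using hb u

lemma card_ker_syndromeMap {K : Type*} [Field K] [Finite K] [Algebra (ZMod 2) K] {s : ℕ}
    (hs : 4 ≤ s) (hd : Module.finrank (ZMod 2) K = 2 * s) {β : K}
    (hβ : IsPrimitiveRoot β (2 ^ s + 1)) :
    Nat.card (LinearMap.ker (syndromeMap (2 ^ s + 1) β)) = 2 ^ (2 ^ s + 1 - 4 * s) := by
  have : FiniteDimensional (ZMod 2) K := Module.Finite.of_finite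
  have h1 := LinearMap.finrank_range_add_finrank_ker (syndromeMap (2 ^ s + 1) β)
  rw [LinearMap.range_eq_top.2 (syndromeMap_surjective hs hd hβ), finrank_top,
    Module.finrank_prod, hd, Module.finrank_fin_fun] at h1
  rw [Module.natCard_eq_pow_finrank (K := ZMod 2), Nat.card_zmod]
  congr 1
  omega

/-- The binary power sums are compatible with the Frobenius endomorphism. -/
lemma sum_mul_pow_two_pow {ι K : Type*} [Fintype ι] [Field K] [CharP K 2] {c : ι → K}
    (hc : ∀ j, c j = 0 ∨ c j = 1) (x : ι → K) (k : ℕ) :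
    (∑ j, c j * x j) ^ 2 ^ k = ∑ j, c j * x j ^ 2 ^ k := by
  rw [sum_pow_char_pow 2 k]
  refine Finset.sum_congr rfl fun j _ => ?_
  rcases hc j with h | h <;> simp [h]

/-- A BCH-type bound: a vector with vanishing weighted power sums of degrees `0, 1, 2, 3` at
distinct nodes has weight at least five. -/
lemma five_le_hammingNorm {ι K : Type*} [Fintype ι] [Field K] [DecidableEq K] {c w z : ι → K}
    (hz : Function.Injective z) (hw : ∀ j, w j ≠ 0)
    (h : ∀ i < 4, ∑ j, c j * (w j * z j ^ i) = 0) (hc : c ≠ 0) : 5 ≤ hammingNorm c := by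
  classical
  by_contra! hlt
  obtain ⟨j₀, hj₀⟩ := Function.ne_iff.1 hc
  set S := Finset.univ.filter fun j => c j ≠ 0 with hS
  have hcard : S.card < 5 := hlt
  have hmem : j₀ ∈ S := by simpa [hS] using hj₀
  let P : Polynomial K := ∏ j ∈ S.erase j₀, (Polynomial.X - Polynomial.C (z j))
  have hdeg : P.natDegree < 4 := by
    rw [Polynomial.natDegree_prod_of_monic _ _ fun j _ => Polynomial.monic_X_sub_C _]
    simp only [Polynomial.natDegree_X_sub_C, Finset.sum_const, Finset.card_erase_of_mem hmem]
    simp only [smul_eq_mul]; omega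
  have h0 : ∑ j, c j * (w j * P.eval (z j)) = 0 := by
    simp only [Polynomial.eval_eq_sum_range' hdeg, Finset.mul_sum]
    rw [Finset.sum_comm]
    refine Finset.sum_eq_zero fun i hi => ?_
    have := congrArg (P.coeff i * ·) (h i (Finset.mem_range.1 hi))
    simp only [Finset.mul_sum, mul_zero] at this
    rw [← this]
    exact Finset.sum_congr rfl fun j _ => by ring
  rw [Finset.sum_eq_single j₀] at h0
  · refine mul_ne_zero hj₀ (mul_ne_zero (hw j₀) ?_) h0
    rw [Polynomial.eval_prod]
    refine Finset.prod_ne_zero_iff.2 fun j hj => ?_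
    simpa [sub_eq_zero] using fun he => (Finset.ne_of_mem_erase hj) (hz he).symm
  · intro j _ hj
    by_cases hcj : c j = 0
    · simp [hcj]
    · have : P.eval (z j) = 0 := by
        rw [Polynomial.eval_prod]
        exact Finset.prod_eq_zero (Finset.mem_erase.2 ⟨hj, by simpa [hS] using hcj⟩) (by simp)
      simp [this]
  · simp

lemma sum_mul_pow_quarter_iff {K : Type*} [Field K] [CharP K 2] {s : ℕ} (hs : 2 ≤ s) {β : K}
    (hβ : β ^ (2 ^ s + 1) = 1) {n : ℕ} {c : Fin n → K} (hc : ∀ j, c j = 0 ∨ c j = 1) :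
    ((∑ j, c j * β ^ (2 ^ (s - 2) * (j : ℕ)) = 0) ∧
      (∑ j, c j * β ^ ((2 ^ (s - 2) + 1) * (j : ℕ)) = 0)) ↔
    (∑ j, c j * β ^ (j : ℕ) = 0) ∧ (∑ j, c j * β ^ (3 * (j : ℕ)) = 0) := by
  have h1 : ∑ j, c j * β ^ (2 ^ (s - 2) * (j : ℕ)) = (∑ j, c j * β ^ (j : ℕ)) ^ 2 ^ (s - 2) := by
    simp only [sum_mul_pow_two_pow hc, ← pow_mul, mul_comm]
  have h2 : (∑ j, c j * β ^ ((2 ^ (s - 2) + 1) * (j : ℕ))) ^ 2 ^ 2 =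
      ∑ j, c j * β ^ (3 * (j : ℕ)) := by
    rw [sum_mul_pow_two_pow hc]
    refine Finset.sum_congr rfl fun j _ => ?_
    have h3 : (2 ^ (s - 2) + 1) * (j : ℕ) * 2 ^ 2 = (2 ^ s + 1) * j + 3 * j := by
      rw [← pow_sub_mul_pow 2 hs]; ring
    rw [← pow_mul, h3, pow_add, pow_mul β (2 ^ s + 1), hβ, one_pow, one_mul]
  rw [h1, ← h2, pow_eq_zero_iff (by positivity), pow_eq_zero_iff (by positivity)]

theorem stmt16 (s : ℕ) (hs : 4 ≤ s) (q : ℕ) (hq : q = 2 ^ s)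
    (h : ℕ) (hh : h = 2 ^ (s - 2))
    (K : Type) [Field K] [Fintype K] [DecidableEq K] (hK : Fintype.card K = q ^ 2)
    (β : K) (hβ : IsPrimitiveRoot β (q + 1))
    (B : Set (Fin (q + 1) → K))
    (hB : B = {c | (∀ j, c j = 0 ∨ c j = 1) ∧
      (∑ j : Fin (q + 1), c j * β ^ (h * (j : ℕ)) = 0) ∧
      (∑ j : Fin (q + 1), c j * β ^ ((h + 1) * (j : ℕ)) = 0)}) :
    B.ncard = 2 ^ (q + 1 - 4 * s) ∧
    ∀ c ∈ B, c ≠ 0 → 5 ≤ hammingNorm c := by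
  subst hq hh
  have hK' : Fintype.card K = 2 ^ (2 * s) := by rw [hK]; ring
  have : CharP K 2 := charP_of_card_eq_prime_pow hK'
  let _ : Algebra (ZMod 2) K := ZMod.algebra K 2
  have hmem (c : Fin (2 ^ s + 1) → K) : c ∈ B ↔ (∀ j, c j = 0 ∨ c j = 1) ∧
      (∑ j, c j * β ^ (j : ℕ) = 0) ∧ (∑ j, c j * β ^ (3 * (j : ℕ)) = 0) := by
    rw [hB, Set.mem_ofPred_eq]
    exact and_congr_right fun hc => sum_mul_pow_quarter_iff (by omega) hβ.pow_eq_one hc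
  constructor
  · have hd : Module.finrank (ZMod 2) K = 2 * s := by
      have h1 := Module.card_eq_pow_finrank (K := ZMod 2) (V := K)
      rw [hK', ZMod.card] at h1
      exact (Nat.pow_right_injective le_rfl h1).symm
    have hinj : Function.Injective
        fun (c : Fin (2 ^ s + 1) → ZMod 2) j => algebraMap (ZMod 2) K (c j) :=
      (algebraMap (ZMod 2) K).injective.comp_left
    have himage : B = (fun (c : Fin (2 ^ s + 1) → ZMod 2) j => algebraMap (ZMod 2) K (c j)) ''
        (LinearMap.ker (syndromeMap (2 ^ s + 1) β) : Set (Fin (2 ^ s + 1) → ZMod 2)) := by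
      have hker (c : Fin (2 ^ s + 1) → ZMod 2) : c ∈ LinearMap.ker (syndromeMap (2 ^ s + 1) β) ↔
          (∑ j, algebraMap (ZMod 2) K (c j) * β ^ (j : ℕ) = 0) ∧
          (∑ j, algebraMap (ZMod 2) K (c j) * β ^ (3 * (j : ℕ)) = 0) := by
        simp only [syndromeMap, LinearMap.mem_ker, Fintype.linearCombination_apply, Prod.ext_iff,
          Prod.fst_sum, Prod.snd_sum, Prod.smul_mk, Prod.fst_zero, Prod.snd_zero]
        simp only [Algebra.smul_def]
      ext c
      rw [hmem, Set.mem_image]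
      constructor
      · rintro ⟨hc, h1, h2⟩
        have hlift (j) : algebraMap (ZMod 2) K (if c j = 0 then 0 else 1) = c j := by
          rcases hc j with h0 | h0 <;> simp [h0]
        refine ⟨fun j => if c j = 0 then 0 else 1, (hker _).2 ?_, funext hlift⟩
        simp only [hlift]
        exact ⟨h1, h2⟩
      · rintro ⟨d, hd, rfl⟩
        refine ⟨fun j => ?_, (hker d).1 hd⟩
        have : ∀ e : ZMod 2, e = 0 ∨ e = 1 := by decide
        rcases this (d j) with h0 | h0 <;> simp [h0]
    rw [himage, Set.ncard_image_of_injective _ hinj]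
    exact card_ker_syndromeMap hs hd hβ
  · intro c hcB hc0
    obtain ⟨hc, h1, h3⟩ := (hmem c).1 hcB
    have hβ0 : β ≠ 0 := hβ.ne_zero (by positivity)
    have hzinj : Function.Injective fun j : Fin (2 ^ s + 1) => (β ^ 2) ^ (j : ℕ) := by
      have hβ2 : IsPrimitiveRoot (β ^ 2) (2 ^ s + 1) := by
        refine hβ.pow_of_coprime 2 ?_
        rw [Nat.coprime_two_left, Nat.odd_add_one, Nat.not_odd_iff_even]
        exact (even_two).pow_of_ne_zero (by omega)
      exact fun i j hij => Fin.ext (hβ2.pow_inj i.2 j.2 hij)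
    have hq1 : ∑ j : Fin (2 ^ s + 1), c j * (β ^ (j : ℕ)) ^ 2 ^ s = 0 := by
      rw [← sum_mul_pow_two_pow hc, h1, zero_pow (by positivity)]
    have hq3 : ∑ j : Fin (2 ^ s + 1), c j * (β ^ (3 * (j : ℕ))) ^ 2 ^ s = 0 := by
      rw [← sum_mul_pow_two_pow hc, h3, zero_pow (by positivity)]
    refine five_le_hammingNorm (w := fun j => (β ^ (3 * (j : ℕ))) ^ 2 ^ s) hzinj
      (fun j => pow_ne_zero _ (pow_ne_zero _ hβ0)) (fun i hi => ?_) hc0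
    have hred (m r j : ℕ) : β ^ ((2 ^ s + 1) * (m * j) + r) = β ^ r := by
      rw [pow_add, pow_mul, hβ.pow_eq_one, one_pow, one_mul]
    interval_cases i
    · simpa using hq3
    · rw [← hq1]
      refine Finset.sum_congr rfl fun j _ => ?_
      rw [← pow_mul β (j : ℕ), ← hred 2 (j * 2 ^ s) j]
      congr 1; ring
    · rw [← h1]
      refine Finset.sum_congr rfl fun j _ => ?_
      rw [← hred 3 j j]
      congr 1; ring
    · rw [← h3]
      refine Finset.sum_congr rfl fun j _ => ?_
      conv_rhs => rw [← hred 3 (3 * j) j]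
      congr 1; ring
end

section
/- Let q = 2^s with s ≥ 2 an even integer, and let h = q/4 = 2^{s−2}. Then the quaternary subfield subcode Q_h = {(c_0,…,c_q) ∈ F_4^{q+1} : ∑_{j=0}^q c_j β^{hj} = 0 and ∑_{j=0}^q c_j β^{(h+1)j} = 0} has F_4-dimension q + 1 − 2s (i.e., it contains exactly 4^{q+1−2s} codewords), and its minimum distance is at least 5. -/
open Polynomial in
/-- The BCH bound: a nonzero vector whose first `r` weighted power sums at distinct points vanish
has weight more than `r`. -/
theorem lt_hammingNorm_of_sum_mul_pow_eq_zero {ι K : Type*} [Fintype ι] [DecidableEq ι] [Field K]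
    [DecidableEq K] {x d : ι → K} (hx : Function.Injective x) {r : ℕ}
    (hd : ∀ i < r, ∑ j, d j * x j ^ i = 0) (hne : d ≠ 0) : r < hammingNorm d := by
  by_contra! hle
  obtain ⟨j₀, hj₀⟩ := Function.ne_iff.mp hne
  set T : Finset ι := Finset.univ.filter fun j => d j ≠ 0 with hT
  have hmem : j₀ ∈ T := by simpa [hT] using hj₀
  set P : K[X] := ∏ j ∈ T.erase j₀, (X - C (x j)) with hP
  have hdeg : P.natDegree < r := by
    have hcard : T.card ≤ r := hle
    have hpos : 0 < T.card := Finset.card_pos.mpr ⟨_, hmem⟩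
    rw [hP, natDegree_prod_of_monic _ _ fun j _ => monic_X_sub_C _]
    simp only [natDegree_X_sub_C, Finset.sum_const, smul_eq_mul, mul_one]
    rw [Finset.card_erase_of_mem hmem]
    omega
  have hsum : ∑ j, d j * P.eval (x j) = 0 := by
    simp_rw [eval_eq_sum_range' hdeg, Finset.mul_sum]
    rw [Finset.sum_comm]
    refine Finset.sum_eq_zero fun i hi => ?_
    have := hd i (Finset.mem_range.mp hi)
    calc ∑ j, d j * (P.coeff i * x j ^ i) = P.coeff i * ∑ j, d j * x j ^ i := by
          rw [Finset.mul_sum]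
          exact Finset.sum_congr rfl fun j _ => by ring
      _ = 0 := by rw [this, mul_zero]
  rw [Finset.sum_eq_single j₀] at hsum
  · refine (mul_ne_zero hj₀ ?_) hsum
    rw [hP, eval_prod, Finset.prod_ne_zero_iff]
    intro j hj
    simpa [sub_eq_zero] using fun h => (Finset.ne_of_mem_erase hj) (hx h).symm
  · intro j _ hj
    by_cases h0 : d j = 0
    · simp [h0]
    · have : P.eval (x j) = 0 := by
        rw [hP, eval_prod]
        exact Finset.prod_eq_zero (i := j) (by simp [hT, hj, h0]) (by simp)
      simp [this]
  · simp

theorem sum_pow_of_pow_eq_one {K : Type*} [Field K] [DecidableEq K] {n : ℕ} {z : K}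
    (hz : z ^ n = 1) : ∑ j : Fin n, z ^ (j : ℕ) = if z = 1 then (n : K) else 0 := by
  rw [Fin.sum_univ_eq_sum_range (fun j => z ^ j)]
  split_ifs with h
  · simp [h]
  · rw [geom_sum_eq h, hz, sub_self, zero_div]

/-- The fixed points of `x ↦ x ^ 4` in characteristic two. -/
def fixedPowFour (K : Type*) [Field K] [CharP K 2] : AddSubgroup K where
  carrier := {x | x ^ 4 = x}
  zero_mem' := by simp
  add_mem' {a b} ha hb := by
    have h := add_pow_char_pow (p := 2) (n := 2) a b
    norm_num at h
    simp only [Set.mem_ofPred_eq] at *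
    rw [h, ha, hb]
  neg_mem' {a} ha := by
    simp only [Set.mem_ofPred_eq] at *
    rw [CharTwo.neg_eq, ha]

theorem mem_fixedPowFour {K : Type*} [Field K] [CharP K 2] {x : K} :
    x ∈ fixedPowFour K ↔ x ^ 4 = x := Iff.rfl

theorem card_fixedPowFour {K : Type*} [Field K] [Fintype K] [CharP K 2]
    (h : 3 ∣ Fintype.card K - 1) : Nat.card (fixedPowFour K) = 4 := by
  classical
  have : Fact (Nat.Prime 3) := ⟨Nat.prime_three⟩
  obtain ⟨w, hw⟩ := exists_prime_orderOf_dvd_card (G := Kˣ) 3 (by rwa [Fintype.card_units])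
  have hprim : IsPrimitiveRoot (w : K) 3 := by
    rw [IsPrimitiveRoot.coe_units_iff, ← hw]
    exact IsPrimitiveRoot.orderOf w
  have hset : (fixedPowFour K : Set K) =
      ((insert 0 (Polynomial.nthRootsFinset 3 (1 : K)) : Finset K) : Set K) := by
    ext x
    simp only [SetLike.mem_coe, mem_fixedPowFour, Finset.coe_insert, Set.mem_insert_iff,
      Polynomial.mem_nthRootsFinset (by norm_num : 0 < 3)]
    constructor
    · intro hx
      by_cases h0 : x = 0
      · exact Or.inl h0
      · exact Or.inr (mul_right_cancel₀ h0 (by rw [one_mul, ← pow_succ, hx]))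
    · rintro (rfl | hx)
      · simp
      · rw [pow_succ, hx, one_mul]
  have : Nat.card (fixedPowFour K) = (fixedPowFour K : Set K).ncard := rfl
  rw [this, hset, Set.ncard_coe_finset, Finset.card_insert_of_notMem, hprim.card_nthRootsFinset]
  simp [Polynomial.mem_nthRootsFinset (by norm_num : 0 < 3)]

theorem add_pow_four_pow {K : Type*} [Field K] [CharP K 2] (i : ℕ) (a b : K) :
    (a + b) ^ 4 ^ i = a ^ 4 ^ i + b ^ 4 ^ i := by
  have h := add_pow_char_pow (p := 2) (n := 2 * i) a b
  rwa [pow_mul] at h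

theorem sum_pow_four {K ι : Type*} [Field K] [CharP K 2] (t : Finset ι) (f : ι → K) :
    (∑ i ∈ t, f i) ^ 4 = ∑ i ∈ t, f i ^ 4 := by
  have h := sum_pow_char_pow (p := 2) (n := 2) t f
  norm_num at h
  exact h

/-- The trace to the four-element subfield lands in it. -/
theorem sum_pow_four_pow_mem {K : Type*} [Field K] [CharP K 2] {s : ℕ} {x : K}
    (hx : x ^ 4 ^ s = x) : ∑ i ∈ Finset.range s, x ^ 4 ^ i ∈ fixedPowFour K := by
  rw [mem_fixedPowFour, sum_pow_four]
  simp_rw [← pow_mul, ← pow_succ]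
  have h₁ := Finset.sum_range_succ (fun i => x ^ 4 ^ i) s
  rw [Finset.sum_range_succ', pow_zero, pow_one, hx] at h₁
  exact add_right_cancel h₁

theorem pow_eq_pow_iff_modEq_of_primitive {K : Type*} [Field K] {n : ℕ} {β : K}
    (hβ : IsPrimitiveRoot β n) (hn : 0 < n) {u v : ℕ} : β ^ u = β ^ v ↔ u ≡ v [MOD n] := by
  rw [IsOfFinOrder.pow_eq_pow_iff_modEq, ← hβ.eq_orderOf]
  exact isOfFinOrder_iff_pow_eq_one.mpr ⟨n, hn, hβ.pow_eq_one⟩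

/-- Orthogonality of powers of a root of unity of odd order in characteristic two. -/
theorem sum_inv_pow_mul_pow {K : Type*} [Field K] [CharP K 2] {n : ℕ} (hn : Odd n) {β : K}
    (hβ : IsPrimitiveRoot β n) (u v i : ℕ) (a : K) :
    ∑ j : Fin n, (a * β⁻¹ ^ (u * (j : ℕ))) ^ 4 ^ i * β ^ (v * (j : ℕ)) =
      if u * 4 ^ i ≡ v [MOD n] then a ^ 4 ^ i else 0 := by
  classical
  have hβ0 : β ≠ 0 := hβ.ne_zero hn.pos.ne'
  have hz : (β⁻¹ ^ (u * 4 ^ i) * β ^ v) ^ n = 1 := by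
    rw [mul_pow, pow_right_comm, pow_right_comm β, inv_pow, hβ.pow_eq_one]
    simp
  have hiff : β⁻¹ ^ (u * 4 ^ i) * β ^ v = 1 ↔ u * 4 ^ i ≡ v [MOD n] := by
    rw [inv_pow, inv_mul_eq_one₀ (pow_ne_zero _ hβ0), pow_eq_pow_iff_modEq_of_primitive hβ hn.pos]
  have hn1 : (n : K) = 1 := by
    obtain ⟨k, rfl⟩ := hn
    push_cast
    simp [CharTwo.two_eq_zero]
  calc _ = a ^ 4 ^ i * ∑ j : Fin n, (β⁻¹ ^ (u * 4 ^ i) * β ^ v) ^ (j : ℕ) := by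
        rw [Finset.mul_sum]
        refine Finset.sum_congr rfl fun j _ => ?_
        rw [mul_pow, mul_pow, mul_assoc]
        simp_rw [← pow_mul]
        rw [mul_right_comm u]
    _ = _ := by
        rw [sum_pow_of_pow_eq_one hz, if_congr hiff rfl rfl, hn1]
        simp

/-- Dual vectors: the sums below single out the coefficient of the frequency `v`. -/
theorem sum_trace_mul_pow {K : Type*} [Field K] [CharP K 2] {n : ℕ} (hn : Odd n) {β : K}
    (hβ : IsPrimitiveRoot β n) {s v w : ℕ} (hs : 0 < s) (a b : K)
    (hv : ∀ i, 0 < i → i < s → ¬ v * 4 ^ i ≡ v [MOD n])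
    (hw : ∀ i < s, ¬ w * 4 ^ i ≡ v [MOD n]) :
    ∑ j : Fin n, (∑ i ∈ Finset.range s,
      (a * β⁻¹ ^ (v * (j : ℕ)) + b * β⁻¹ ^ (w * (j : ℕ))) ^ 4 ^ i) * β ^ (v * (j : ℕ)) = a := by
  simp_rw [Finset.sum_mul]
  rw [Finset.sum_comm]
  simp_rw [add_pow_four_pow, add_mul, Finset.sum_add_distrib, sum_inv_pow_mul_pow hn hβ]
  rw [Finset.sum_eq_single 0, Finset.sum_eq_zero, add_zero]
  · simp [Nat.ModEq.refl]
  · intro i hi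
    rw [if_neg (hw i (Finset.mem_range.mp hi))]
  · intro i hi h0
    rw [if_neg (hv i (Nat.pos_of_ne_zero h0) (Finset.mem_range.mp hi))]
  · intro h
    simp [hs] at h

/-- `4 ^ i` is congruent to `± 4 ^ k` modulo `4 ^ m + 1`, with `k < m`. -/
theorem exists_dvd_four_pow_sub_or_add {m i : ℕ} (hi : i < 2 * m) :
    ∃ k : ℕ, 4 * (4 : ℤ) ^ k ≤ 4 ^ m ∧ (i = k ∨ ((4 : ℤ) ^ m + 1 ∣ 4 ^ i + 4 ^ k)) := by
  rcases lt_or_ge i m with hlt | hge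
  · refine ⟨i, ?_, Or.inl rfl⟩
    rw [← pow_succ']
    exact pow_le_pow_right₀ (by norm_num) hlt
  · obtain ⟨k, rfl⟩ := Nat.exists_eq_add_of_le hge
    refine ⟨k, ?_, Or.inr ⟨4 ^ k, by ring⟩⟩
    rw [← pow_succ']
    exact pow_le_pow_right₀ (by norm_num) (by omega)

theorem not_dvd_of_pos_of_lt {a b : ℤ} (h0 : 0 < b) (hlt : b < a) : ¬ a ∣ b := fun h =>
  absurd (Int.le_of_dvd h0 h) (not_le.mpr hlt)

theorem four_pow_eq_one_or_le (k : ℕ) : (k = 0 ∧ (4 : ℤ) ^ k = 1) ∨ (4 : ℤ) ≤ 4 ^ k := by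
  rcases Nat.eq_zero_or_pos k with rfl | hk
  · simp
  · exact Or.inr (by simpa using pow_le_pow_right₀ (by norm_num : (1 : ℤ) ≤ 4) hk)

theorem four_pow_eq_four_or_le {m : ℕ} (hm : 0 < m) : (4 : ℤ) ^ m = 4 ∨ (16 : ℤ) ≤ 4 ^ m := by
  obtain ⟨k, rfl⟩ := Nat.exists_eq_succ_of_ne_zero hm.ne'
  rw [pow_succ]
  rcases four_pow_eq_one_or_le k with h | h <;> omega

section Cosets

variable {m h i : ℕ}

theorem not_dvd_three_mul_four_pow_sub_one (hm : 0 < m) (hi0 : 0 < i) (hi : i < 2 * m) :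
    ¬ (4 : ℤ) ^ m + 1 ∣ 3 * (4 ^ i - 1) := by
  intro hd
  obtain ⟨k, hk, rfl | hk'⟩ := exists_dvd_four_pow_sub_or_add hi
  · rcases four_pow_eq_one_or_le i with h | h
    · omega
    · exact not_dvd_of_pos_of_lt (by omega) (by omega) hd
  · have hd' : (4 : ℤ) ^ m + 1 ∣ 3 * (4 ^ k + 1) := by
      have := dvd_sub (hk'.mul_left 3) hd
      ring_nf at this ⊢
      exact this
    have hpos : (0 : ℤ) < 4 ^ k := by positivity
    rcases four_pow_eq_four_or_le hm with h | h
    · have h1 : (4 : ℤ) ^ k = 1 := by omega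
      rw [h, h1] at hd'
      norm_num at hd'
    · exact not_dvd_of_pos_of_lt (by omega) (by omega) hd'

theorem not_dvd_three_mul_four_pow_add_one (hi : i < 2 * m) :
    ¬ (4 : ℤ) ^ m + 1 ∣ 3 * 4 ^ i + 1 := by
  intro hd
  obtain ⟨k, hk, rfl | hk'⟩ := exists_dvd_four_pow_sub_or_add hi
  · have hpos : (0 : ℤ) < 4 ^ i := by positivity
    exact not_dvd_of_pos_of_lt (by omega) (by omega) hd
  · have hd' : (4 : ℤ) ^ m + 1 ∣ 3 * 4 ^ k - 1 := by
      have := dvd_sub (hk'.mul_left 3) hd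
      ring_nf at this ⊢
      exact this
    have hpos : (0 : ℤ) < 4 ^ k := by positivity
    exact not_dvd_of_pos_of_lt (by omega) (by omega) hd'

theorem not_dvd_four_pow_add_three (hm : 0 < m) (hi : i < 2 * m) :
    ¬ (4 : ℤ) ^ m + 1 ∣ 4 ^ i + 3 := by
  intro hd
  have hQ := four_pow_eq_four_or_le hm
  obtain ⟨k, hk, rfl | hk'⟩ := exists_dvd_four_pow_sub_or_add hi
  · have hpos : (0 : ℤ) < 4 ^ i := by positivity
    exact not_dvd_of_pos_of_lt (by omega) (by omega) hd
  · have hd' : (4 : ℤ) ^ m + 1 ∣ 4 ^ k - 3 := by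
      have := dvd_sub hk' hd
      ring_nf at this ⊢
      exact this
    rcases four_pow_eq_one_or_le k with h | h
    · rw [h.2] at hd'
      exact not_dvd_of_pos_of_lt (by norm_num) (by omega) ((dvd_neg.mpr hd' : _ ∣ (2 : ℤ)))
    · exact not_dvd_of_pos_of_lt (by omega) (by omega) hd'

theorem not_modEq_mul_four_pow_self (hm : 0 < m) (hh : 4 * h = 4 ^ m) (hi0 : 0 < i)
    (hi : i < 2 * m) : ¬ h * 4 ^ i ≡ h [MOD 4 ^ m + 1] := by
  intro hd
  rw [Nat.modEq_iff_dvd] at hd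
  push_cast at hd
  refine not_dvd_three_mul_four_pow_sub_one hm hi0 hi ?_
  have hh' : (4 * h : ℤ) = 4 ^ m := by exact_mod_cast hh
  obtain ⟨t, ht⟩ := hd
  exact ⟨12 * t + 3 * (4 ^ i - 1), by linear_combination 12 * ht - 3 * (1 - 4 ^ i) * hh'⟩

theorem not_modEq_succ_mul_four_pow_self (hm : 0 < m) (hh : 4 * h = 4 ^ m) (hi0 : 0 < i)
    (hi : i < 2 * m) : ¬ (h + 1) * 4 ^ i ≡ h + 1 [MOD 4 ^ m + 1] := by
  intro hd
  rw [Nat.modEq_iff_dvd] at hd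
  push_cast at hd
  refine not_dvd_three_mul_four_pow_sub_one hm hi0 hi ?_
  have hh' : (4 * h : ℤ) = 4 ^ m := by exact_mod_cast hh
  obtain ⟨t, ht⟩ := hd
  exact ⟨-4 * t - (4 ^ i - 1), by linear_combination -4 * ht + (1 - 4 ^ i) * hh'⟩

theorem not_modEq_succ_mul_four_pow (hh : 4 * h = 4 ^ m) (hi : i < 2 * m) :
    ¬ (h + 1) * 4 ^ i ≡ h [MOD 4 ^ m + 1] := by
  intro hd
  rw [Nat.modEq_iff_dvd] at hd
  push_cast at hd
  refine not_dvd_three_mul_four_pow_add_one hi ?_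
  have hh' : (4 * h : ℤ) = 4 ^ m := by exact_mod_cast hh
  obtain ⟨t, ht⟩ := hd
  exact ⟨-4 * t - 4 ^ i + 1, by linear_combination -4 * ht + (1 - 4 ^ i) * hh'⟩

theorem not_modEq_mul_four_pow_succ (hm : 0 < m) (hh : 4 * h = 4 ^ m) (hi : i < 2 * m) :
    ¬ h * 4 ^ i ≡ h + 1 [MOD 4 ^ m + 1] := by
  intro hd
  rw [Nat.modEq_iff_dvd] at hd
  push_cast at hd
  refine not_dvd_four_pow_add_three hm hi ?_
  have hh' : (4 * h : ℤ) = 4 ^ m := by exact_mod_cast hh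
  obtain ⟨t, ht⟩ := hd
  exact ⟨4 * t + 4 ^ i - 1, by linear_combination 4 * ht - (1 - 4 ^ i) * hh'⟩

end Cosets

/-- Two power sums of a vector over the four-element subfield, as an additive map. -/
def powerSumsHom {K : Type*} [Field K] [CharP K 2] (β : K) (n v w : ℕ) :
    (Fin n → fixedPowFour K) →+ K × K where
  toFun c := (∑ j, (c j : K) * β ^ (v * (j : ℕ)), ∑ j, (c j : K) * β ^ (w * (j : ℕ)))
  map_zero' := by simp
  map_add' a b := by simp [add_mul, Finset.sum_add_distrib]

theorem powerSumsHom_surjective {K : Type*} [Field K] [Fintype K] [CharP K 2] {m h : ℕ}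
    (hm : 0 < m) (hh : 4 * h = 4 ^ m) (hK : Fintype.card K = 4 ^ (2 * m)) {β : K}
    (hβ : IsPrimitiveRoot β (4 ^ m + 1)) :
    Function.Surjective (powerSumsHom β (4 ^ m + 1) h (h + 1)) := by
  rintro ⟨a, b⟩
  have hn : Odd (4 ^ m + 1) := ⟨2 * h, by omega⟩
  refine ⟨fun j => ⟨∑ i ∈ Finset.range (2 * m),
    (a * β⁻¹ ^ (h * (j : ℕ)) + b * β⁻¹ ^ ((h + 1) * (j : ℕ))) ^ 4 ^ i,
    sum_pow_four_pow_mem (by rw [← hK, FiniteField.pow_card])⟩, ?_⟩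
  refine Prod.ext ?_ ?_
  · exact sum_trace_mul_pow hn hβ (by omega) a b
      (fun i => not_modEq_mul_four_pow_self hm hh)
      (fun i => not_modEq_succ_mul_four_pow hh)
  · have := sum_trace_mul_pow hn hβ (by omega : 0 < 2 * m) b a
      (fun i => not_modEq_succ_mul_four_pow_self hm hh)
      (fun i => not_modEq_mul_four_pow_succ hm hh)
    simp_rw [add_comm (b * _)] at this
    exact this

theorem card_ker_mul_card_of_surjective {G H : Type*} [AddCommGroup G] [AddCommGroup H]
    {f : G →+ H} (hf : Function.Surjective f) : Nat.card f.ker * Nat.card H = Nat.card G := by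
  rw [AddSubgroup.card_eq_card_quotient_mul_card_addSubgroup f.ker, mul_comm,
    Nat.card_congr (QuotientAddGroup.quotientKerEquivOfSurjective f hf).toEquiv]

theorem two_mul_two_mul_le_four_pow_add_one {m : ℕ} (hm : 0 < m) : 2 * (2 * m) ≤ 4 ^ m + 1 := by
  induction m, hm using Nat.le_induction with
  | base => norm_num
  | succ k hk ih =>
    rw [pow_succ]
    omega

theorem ncard_code {K : Type*} [Field K] [Fintype K] [CharP K 2] {m h : ℕ}
    (hm : 0 < m) (hh : 4 * h = 4 ^ m) (hK : Fintype.card K = 4 ^ (2 * m)) {β : K}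
    (hβ : IsPrimitiveRoot β (4 ^ m + 1)) :
    {c : Fin (4 ^ m + 1) → K | (∀ j, (c j) ^ 4 = c j) ∧
      (∑ j : Fin (4 ^ m + 1), c j * β ^ (h * (j : ℕ)) = 0) ∧
      (∑ j : Fin (4 ^ m + 1), c j * β ^ ((h + 1) * (j : ℕ)) = 0)}.ncard =
    4 ^ (4 ^ m + 1 - 2 * (2 * m)) := by
  set f := powerSumsHom β (4 ^ m + 1) h (h + 1)
  have h3 : 3 ∣ Fintype.card K - 1 := by
    rw [hK]
    simpa using Nat.sub_dvd_pow_sub_pow 4 1 (2 * m)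
  have himage : {c : Fin (4 ^ m + 1) → K | (∀ j, (c j) ^ 4 = c j) ∧
      (∑ j : Fin (4 ^ m + 1), c j * β ^ (h * (j : ℕ)) = 0) ∧
      (∑ j : Fin (4 ^ m + 1), c j * β ^ ((h + 1) * (j : ℕ)) = 0)} =
      (fun c j => (c j : K)) '' (f.ker : Set (Fin (4 ^ m + 1) → fixedPowFour K)) := by
    ext c
    constructor
    · rintro ⟨h₁, h₂, h₃⟩
      exact ⟨fun j => ⟨c j, h₁ j⟩, Prod.ext h₂ h₃, rfl⟩
    · rintro ⟨d, hd, rfl⟩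
      exact ⟨fun j => (d j).2, congrArg Prod.fst hd, congrArg Prod.snd hd⟩
  have hinj : Function.Injective
      (fun (c : Fin (4 ^ m + 1) → fixedPowFour K) j => (c j : K)) := fun a b hab =>
    funext fun j => Subtype.ext (congrFun hab j)
  have hcard := card_ker_mul_card_of_surjective (powerSumsHom_surjective hm hh hK hβ)
  rw [Nat.card_prod, Nat.card_eq_fintype_card (α := K), hK, Nat.card_fun, card_fixedPowFour h3,
    Nat.card_fin, ← pow_add, ← two_mul] at hcard
  rw [himage, Set.ncard_image_of_injective _ hinj]
  change Nat.card f.ker = _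
  refine Nat.eq_of_mul_eq_mul_right (by positivity) (hcard.trans ?_)
  rw [← pow_add, Nat.sub_add_cancel (two_mul_two_mul_le_four_pow_add_one hm)]

theorem five_le_hammingNorm_code {K : Type*} [Field K] [DecidableEq K] [CharP K 2] {m h : ℕ}
    (hh : 4 * h = 4 ^ m) {β : K} (hβ : IsPrimitiveRoot β (4 ^ m + 1))
    {c : Fin (4 ^ m + 1) → K} (hc : ∀ j, (c j) ^ 4 = c j)
    (h₁ : ∑ j : Fin (4 ^ m + 1), c j * β ^ (h * (j : ℕ)) = 0)
    (h₂ : ∑ j : Fin (4 ^ m + 1), c j * β ^ ((h + 1) * (j : ℕ)) = 0) (hne : c ≠ 0) :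
    5 ≤ hammingNorm c := by
  have hβ0 : β ≠ 0 := hβ.ne_zero (by positivity)
  have hn : 0 < 4 ^ m + 1 := by positivity
  set S : ℕ → K := fun k => ∑ j : Fin (4 ^ m + 1), c j * β ^ (k * (j : ℕ)) with hS
  have hmul (k : ℕ) (hk : S k = 0) : S (k * 4) = 0 := by
    have : S (k * 4) = S k ^ 4 := by
      simp only [hS]
      rw [sum_pow_four]
      refine Finset.sum_congr rfl fun j _ => ?_
      rw [mul_pow, hc, ← pow_mul, mul_right_comm]
    rw [this, hk, zero_pow (by norm_num)]
  have hmulpow (k t : ℕ) (hk : S k = 0) : S (k * 4 ^ t) = 0 := by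
    induction t with
    | zero => simpa using hk
    | succ t ih => rw [pow_succ, ← mul_assoc]; exact hmul _ ih
  have hmod {k l : ℕ} (hkl : k ≡ l [MOD 4 ^ m + 1]) (hk : S k = 0) : S l = 0 := by
    rw [← hk]
    refine Finset.sum_congr rfl fun j _ => ?_
    rw [(pow_eq_pow_iff_modEq_of_primitive hβ hn).mpr (hkl.mul_right _)]
  have e₂ : S (4 ^ m) = 0 := by
    have := hmul _ h₁
    rwa [mul_comm, hh] at this
  have e₄ : S (4 ^ m + 4) = 0 := by
    have := hmul _ h₂
    rwa [add_mul, mul_comm, hh] at this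
  have hq : 4 ≤ 4 ^ m := by
    have : 0 < 4 ^ m := by positivity
    omega
  obtain ⟨e, he⟩ := Nat.exists_eq_add_of_le' (show 2 ≤ 4 ^ m by omega)
  have e₃ : S (4 ^ m + 2) = 0 := by
    refine hmod ?_ (hmulpow _ m e₂)
    rw [Nat.modEq_iff_dvd, he]
    exact ⟨-e, by push_cast; ring⟩
  have e₁ : S e = 0 := by
    refine hmod ?_ (hmulpow _ m e₄)
    rw [Nat.modEq_iff_dvd, he]
    exact ⟨-(e + 4), by push_cast; ring⟩
  have hinj : Function.Injective fun j : Fin (4 ^ m + 1) => β ^ (2 * (j : ℕ)) := by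
    intro a b hab
    have hab' := (pow_eq_pow_iff_modEq_of_primitive hβ hn).mp hab
    have hco : Nat.gcd (4 ^ m + 1) 2 = 1 := by
      rw [← Nat.coprime_iff_gcd_eq_one, Nat.coprime_two_right]
      exact ⟨2 * h, by omega⟩
    exact Fin.ext ((hab'.cancel_left_of_coprime hco).eq_of_lt_of_lt a.2 b.2)
  have hnorm : hammingNorm (fun j => c j * β ^ (e * (j : ℕ))) = hammingNorm c := by
    simp [hammingNorm, hβ0]
  rw [← hnorm]
  refine lt_hammingNorm_of_sum_mul_pow_eq_zero hinj (r := 4) (fun i hi => ?_) ?_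
  · have key : S (e + 2 * i) = 0 := by
      interval_cases i
      · exact e₁
      · rwa [← he]
      · rwa [he] at e₃
      · rwa [he] at e₄
    rw [← key]
    refine Finset.sum_congr rfl fun j _ => ?_
    rw [mul_assoc, ← pow_mul, ← pow_add]
    congr 2
    ring
  · rwa [← hammingNorm_ne_zero_iff, hnorm, hammingNorm_ne_zero_iff]

theorem stmt17 (s : ℕ) (hs : 2 ≤ s) (hseven : Even s) (q : ℕ) (hq : q = 2 ^ s)
    (h : ℕ) (hh : h = 2 ^ (s - 2))
    (K : Type) [Field K] [Fintype K] [DecidableEq K] (hK : Fintype.card K = q ^ 2)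
    (β : K) (hβ : IsPrimitiveRoot β (q + 1))
    (Q : Set (Fin (q + 1) → K))
    (hQ : Q = {c | (∀ j, (c j) ^ 4 = c j) ∧
      (∑ j : Fin (q + 1), c j * β ^ (h * (j : ℕ)) = 0) ∧
      (∑ j : Fin (q + 1), c j * β ^ ((h + 1) * (j : ℕ)) = 0)}) :
    Q.ncard = 4 ^ (q + 1 - 2 * s) ∧
    ∀ c ∈ Q, c ≠ 0 → 5 ≤ hammingNorm c := by
  obtain ⟨m, rfl⟩ := hseven
  have hm : 0 < m := by omega
  obtain rfl : q = 4 ^ m := by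
    rw [hq, ← two_mul, pow_mul]
    norm_num
  have hh' : 4 * h = 4 ^ m := by
    rw [hh, hq, show (4 : ℕ) = 2 ^ 2 from rfl, ← pow_add]
    congr 1
    omega
  have hK' : Fintype.card K = 4 ^ (2 * m) := by rw [hK, ← pow_mul, mul_comm]
  have hchar : CharP K 2 := by
    refine charP_of_card_eq_prime_pow (f := 2 * (2 * m)) ?_
    rw [hK', pow_mul 2]
    norm_num
  subst hQ
  refine ⟨?_, fun c hc hne => five_le_hammingNorm_code hh' hβ hc.1 hc.2.1 hc.2.2 hne⟩
  rw [← two_mul m]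
  exact ncard_code hm hh' hK' hβ
end
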